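/- Let V be a K-vector space (K a field of characteristic 0) of dimension n, and let u be an invertible semisimple endomorphism of V. Then for every r ≥ 0, the induced endomorphism Λ^r(u) of the exterior power Λ^r V is semisimple. -/

import Mathlib

open Polynomial in
theorem aux_aeval {K V W : Type*} [Field K] [AddCommGroup V] [Module K V]
    [AddCommGroup W] [Module K W] (u : Module.End K V) {r : ℕ} (i : Fin r)
    (P : Module.End K (MultilinearMap K (fun _ : Fin r => V) W))
    (hP : ∀ f m, P f m = f (Function.update m i (u (m i)))) (q : K[X]) :
    ∀ f m, (aeval P q) f m = f (Function.update m i (aeval u q (m i))) := by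
  have hpow : ∀ (n : ℕ) f m, (P ^ n) f m = f (Function.update m i ((u ^ n) (m i))) := by
    intro n
    induction n with
    | zero => intro f m; simp
    | succ n ih =>
      intro f m
      rw [pow_succ, Module.End.mul_apply, ih, hP, pow_succ']
      simp
  induction q using Polynomial.induction_on' with
  | add p q hp hq => intro f m; simp [hp, hq]
  | monomial n a => intro f m; simp [aeval_monomial, hpow, Module.algebraMap_end_apply]

theorem aux_semisimple {K V W : Type*} [Field K] [CharZero K] [AddCommGroup V] [Module K V]
    [FiniteDimensional K V] [AddCommGroup W] [Module K W] [FiniteDimensional K W]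
    (u : Module.End K V) (hss : u.IsSemisimple) {r : ℕ} (s : Finset (Fin r)) :
    Module.End.IsSemisimple (MultilinearMap.compLinearMapₗ (ι := Fin r) (M₂ := W)
      (fun i => if i ∈ s then u else LinearMap.id) : Module.End K
        (MultilinearMap K (fun _ : Fin r => V) W)) := by
  induction s using Finset.induction_on with
  | empty =>
    convert Module.End.isSemisimple_id
    · ext f m
      simp
    · infer_instance
  | insert i s hi ih =>
    have h1 : Module.End.IsSemisimple (MultilinearMap.compLinearMapₗ (ι := Fin r) (M₂ := W)
      (fun j => if j = i then u else LinearMap.id) : Module.End K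
        (MultilinearMap K (fun _ : Fin r => V) W)) := by
      refine Module.End.isSemisimple_of_squarefree_aeval_eq_zero hss.minpoly_squarefree ?_
      ext f m
      rw [aux_aeval u i]
      · rw [minpoly.aeval]
        exact f.map_coord_zero i (by simp)
      · intro f m
        simp only [MultilinearMap.compLinearMapₗ_apply, MultilinearMap.compLinearMap_apply]
        congr 1
        ext j
        by_cases h : j = i
        · subst h; simp
        · simp [h]
    convert Module.End.IsSemisimple.mul_of_commute (?_ : Commute _ _) ih h1 using 1
    · ext f m
      simp only [MultilinearMap.compLinearMapₗ_apply, MultilinearMap.compLinearMap_apply,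
        Module.End.mul_apply]
      congr 1
      ext j
      by_cases h : j = i
      · subst h; simp [hi]
      · simp [h]
    · ext f m
      simp only [MultilinearMap.compLinearMapₗ_apply, MultilinearMap.compLinearMap_apply,
        Module.End.mul_apply]
      congr 1
      ext j
      by_cases h : j = i
      · subst h; simp [hi]
      · simp [h]

theorem aux_poly {K V W : Type*} [Field K] [CharZero K] [AddCommGroup V] [Module K V]
    [FiniteDimensional K V] [AddCommGroup W] [Module K W] [FiniteDimensional K W]
    (u : Module.End K V) (hss : u.IsSemisimple) {r : ℕ} (w : Module.End K W)
    (g : MultilinearMap K (fun _ : Fin r => V) W)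
    (hι : ∀ m : Fin r → V, w (g m) = g (fun i => u (m i))) :
    ∃ q : Polynomial K, Squarefree q ∧ ∀ m, (Polynomial.aeval w q) (g m) = 0 := by
  have hU := aux_semisimple (W := W) u hss (Finset.univ : Finset (Fin r))
  set P : Module.End K (MultilinearMap K (fun _ : Fin r => V) W) :=
    MultilinearMap.compLinearMapₗ (ι := Fin r) (M₂ := W)
      (fun i => if i ∈ (Finset.univ : Finset (Fin r)) then u else LinearMap.id) with hPdef
  have hP : ∀ f m, P f m = f (fun i => u (m i)) := by
    intro f m
    simp [hPdef]
  have hpow : ∀ (n : ℕ) (m : Fin r → V),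
      (P ^ n) g m
        = (w ^ n) (g m) := by
    intro n
    induction n with
    | zero => intro m; simp
    | succ n ih =>
      intro m
      rw [pow_succ', Module.End.mul_apply, hP, ih, pow_succ, Module.End.mul_apply, hι]
  have key : ∀ (q : Polynomial K) (m : Fin r → V),
      (Polynomial.aeval P q) g m
        = (Polynomial.aeval w q) (g m) := by
    intro q
    induction q using Polynomial.induction_on' with
    | add p q hp hq => intro m; simp [hp, hq]
    | monomial n a =>
      intro m
      simp [Polynomial.aeval_monomial, hpow, Module.algebraMap_end_apply]
  refine ⟨minpoly K P, hU.minpoly_squarefree, fun m => ?_⟩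
  rw [← key, minpoly.aeval]
  rfl

/-- Let `V` be an `n`-dimensional vector space over a field `K` of characteristic 0 and `u`
an invertible semisimple endomorphism of `V`. Then for every `r ≥ 0`, the induced
endomorphism `Λ^r u` of the exterior power `⋀[K]^r V` (i.e. any endomorphism of `⋀[K]^r V`
that agrees with the algebra map `ExteriorAlgebra.map u` on the `r`-th exterior power)
is semisimple. -/
theorem stmt_6 {K V : Type*} [Field K] [CharZero K] [AddCommGroup V] [Module K V]
    [FiniteDimensional K V] (n : ℕ) (hn : Module.finrank K V = n)
    (u : Module.End K V) (hu : IsUnit u) (hss : u.IsSemisimple) (r : ℕ)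
    (w : Module.End K (⋀[K]^r V))
    (hw : ∀ x : ⋀[K]^r V, (w x : ExteriorAlgebra K V) = ExteriorAlgebra.map u x) :
    w.IsSemisimple := by
  have hι : ∀ m : Fin r → V, w (exteriorPower.ιMulti K r m)
      = exteriorPower.ιMulti K r (fun i => u (m i)) := by
    intro m
    apply Subtype.ext
    rw [hw]
    simp [ExteriorAlgebra.map_apply_ιMulti, Function.comp_def]
  obtain ⟨q, hq, h⟩ := aux_poly u hss w (exteriorPower.ιMulti K r).toMultilinearMap hι
  refine Module.End.isSemisimple_of_squarefree_aeval_eq_zero hq ?_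
  apply exteriorPower.linearMap_ext
  ext1 m
  simpa using h m
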